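/- Let T ⊆ M, let Q be a set of monoid projections on M, and let I be a radical order ideal of M. Then there exists a subset T₀ ⊆ T with card T₀ < κ(Q[T], I) such that: (a) for every Q ∈ Q, Q(f) ∈ I for all f ∈ T if and only if Q(f) ∈ I for all f ∈ T₀; and (b) for every h ∈ Q[T], one has h·k ∈ I for every k ∈ Q[T₀] if and only if h ∈ I. -/

import Mathlib

open Cardinal

/-- A positively ordered (p.o.) monoid. -/
class POMonoid (M : Type*) extends CommMonoid M, PartialOrder M, OrderBot M where
  le_one : ∀ f : M, f ≤ 1
  mul_le_mul_of_le : ∀ {f g : M}, f ≤ g → ∀ h : M, f * h ≤ g * h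

/-- An order ideal: downward closed set. -/
def IsOrderIdeal {M : Type*} [POMonoid M] (I : Set M) : Prop :=
  ∀ f ∈ I, ∀ g : M, g ≤ f → g ∈ I

/-- A radical set: `f ∈ I` whenever `f ^ n ∈ I` for some `n ≥ 1`. -/
def IsRadicalSet {M : Type*} [POMonoid M] (I : Set M) : Prop :=
  ∀ f : M, ∀ n : ℕ, 1 ≤ n → f ^ n ∈ I → f ∈ I

/-- `D` is mutually `I`-disjoint. -/
def MutuallyDisjointMod {M : Type*} [POMonoid M] (I D : Set M) : Prop :=
  D ∩ I = ∅ ∧ ∀ f ∈ D, ∀ g ∈ D, f ≠ g → f * g ∈ I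

/-- `κ(T, I)`. -/
noncomputable def kappa {M : Type*} [POMonoid M] (T I : Set M) : Cardinal :=
  sInf {c : Cardinal | ∀ D : Set M, D ⊆ T → MutuallyDisjointMod I D → #D < c}

/-- A monoid projection. -/
def IsMonoidProjection {M : Type*} [POMonoid M] (Q : M → M) : Prop :=
  Monotone Q ∧ (∀ f : M, Q f ≤ f) ∧ ∀ f g : M, f * Q g ≤ Q (f * g)

/-- `𝒬[T] = {Q f : Q ∈ 𝒬, f ∈ T}`. -/
def projImage {M : Type*} [POMonoid M] (𝒬 : Set (M → M)) (T : Set M) : Set M :=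
  {h : M | ∃ Q ∈ 𝒬, ∃ f ∈ T, Q f = h}

namespace POMonoid

variable {M : Type*} [POMonoid M]

theorem mul_le_left (f g : M) : f * g ≤ f := by
  simpa [mul_comm] using mul_le_mul_of_le (le_one g) f

end POMonoid

/-- The cardinal `κ(T, I)` strictly bounds every mutually `I`-disjoint subset of `T`. -/
theorem MutuallyDisjointMod.mk_lt_kappa {M : Type*} [POMonoid M] {T I D : Set M}
    (hD : MutuallyDisjointMod I D) (hDT : D ⊆ T) : #D < kappa T I := by
  have hne : {c : Cardinal | ∀ D : Set M, D ⊆ T → MutuallyDisjointMod I D → #D < c}.Nonempty :=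
    ⟨Order.succ #M, fun D _ _ => Order.lt_succ_of_le (mk_set_le D)⟩
  exact csInf_mem hne D hDT hD

/-- Every set `S` contains a mutually `I`-disjoint subset `D` such that each element of `S` that is
`I`-disjoint from all of `D` lies in the radical set `I`. -/
theorem IsRadicalSet.exists_mutuallyDisjointMod {M : Type*} [POMonoid M] {I : Set M}
    (hrad : IsRadicalSet I) (S : Set M) :
    ∃ D ⊆ S, MutuallyDisjointMod I D ∧ ∀ h ∈ S, (∀ d ∈ D, h * d ∈ I) → h ∈ I := by
  obtain ⟨D, hD⟩ := zorn_subset {D : Set M | D ⊆ S ∧ MutuallyDisjointMod I D} (by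
    intro c hc hchain
    refine ⟨⋃₀ c, ⟨Set.sUnion_subset fun D hD => (hc hD).1, ?_, ?_⟩,
      fun D hD => Set.subset_sUnion_of_mem hD⟩
    · rw [Set.eq_empty_iff_forall_notMem]
      rintro x ⟨⟨D, hD, hxD⟩, hxI⟩
      exact Set.eq_empty_iff_forall_notMem.1 (hc hD).2.1 x ⟨hxD, hxI⟩
    · rintro f ⟨D, hD, hfD⟩ g ⟨E, hE, hgE⟩ hfg
      rcases hchain.total hD hE with hDE | hED
      · exact (hc hE).2.2 f (hDE hfD) g hgE hfg
      · exact (hc hD).2.2 f hfD g (hED hgE) hfg)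
  obtain ⟨hDS, hDI, hdisj⟩ := hD.prop
  refine ⟨D, hDS, ⟨hDI, hdisj⟩, fun h hS hh => ?_⟩
  by_contra hI
  have hins : insert h D ∈ {D : Set M | D ⊆ S ∧ MutuallyDisjointMod I D} := by
    refine ⟨Set.insert_subset hS hDS, ?_, ?_⟩
    · rw [Set.insert_inter_of_notMem hI, hDI]
    · rintro f (rfl | hf) g (rfl | hg) hfg
      · exact absurd rfl hfg
      · exact hh g hg
      · rw [mul_comm]
        exact hh f hf
      · exact hdisj f hf g hg hfg
  have hhD : h ∈ D := hD.le_of_ge hins (Set.subset_insert h D) (Set.mem_insert h D)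
  exact hI (hrad h 2 one_le_two (by simpa [sq] using hh h hhD))

/-- Main projection theorem: one may reduce the projection problem to a subset
`T₀ ⊆ T` of cardinality `< κ(𝒬[T], I)`; moreover an element of `𝒬[T]` is
`I`-disjoint from all of `𝒬[T₀]` iff it lies in `I`. -/
theorem stmt7 {M : Type*} [POMonoid M] (T : Set M) (𝒬 : Set (M → M))
    (h𝒬 : ∀ Q ∈ 𝒬, IsMonoidProjection Q) (I : Set M)
    (hord : IsOrderIdeal I) (hrad : IsRadicalSet I) :
    ∃ T₀ : Set M, T₀ ⊆ T ∧ #T₀ < kappa (projImage 𝒬 T) I ∧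
      (∀ Q ∈ 𝒬, ((∀ f ∈ T, Q f ∈ I) ↔ (∀ f ∈ T₀, Q f ∈ I))) ∧
      (∀ h ∈ projImage 𝒬 T,
        ((∀ k ∈ projImage 𝒬 T₀, h * k ∈ I) ↔ h ∈ I)) := by
  obtain ⟨D, hDS, hD, hmax⟩ := hrad.exists_mutuallyDisjointMod (projImage 𝒬 T)
  choose P hP F hF hPF using hDS
  refine ⟨Set.range fun d : D => F d.2, ?_, mk_range_le.trans_lt (hD.mk_lt_kappa ?_), ?_, ?_⟩
  · rintro _ ⟨d, rfl⟩
    exact hF d.2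
  · exact fun d hd => ⟨P hd, hP hd, F hd, hF hd, hPF hd⟩
  · refine fun Q hQ => ⟨fun h => ?_, fun h f hf => hmax (Q f) ⟨Q, hQ, f, hf, rfl⟩ fun d hd => ?_⟩
    · rintro _ ⟨d, rfl⟩
      exact h _ (hF d.2)
    · obtain ⟨hmono, -, hmul⟩ := h𝒬 Q hQ
      refine hord _ (h _ ⟨⟨d, hd⟩, rfl⟩) _ ?_
      calc Q f * d = d * Q f := mul_comm _ _
        _ ≤ F hd * Q f := by
          refine POMonoid.mul_le_mul_of_le ?_ _
          simpa only [hPF hd] using (h𝒬 _ (hP hd)).2.1 (F hd)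
        _ ≤ Q (F hd * f) := hmul _ _
        _ ≤ Q (F hd) := hmono (POMonoid.mul_le_left _ _)
  · refine fun h hh => ⟨fun hk => hmax h hh fun d hd => hk d ?_, fun hI k _ =>
      hord h hI _ (POMonoid.mul_le_left h k)⟩
    exact ⟨P hd, hP hd, F hd, ⟨⟨d, hd⟩, rfl⟩, hPF hd⟩
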